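/- Let n ≥ 3 and let u : S^{n-1} → ℝ be a smooth function. For x ∈ S^{n-1}, let λ₁^{∇²u}(x) ≤ λ₂^{∇²u}(x) ≤ ⋯ ≤ λ_{n-1}^{∇²u}(x) be the eigenvalues of the Hessian ∇²u(x) on the sphere. Then ∫_{S^{n-1}} ∇²u[∇u, ∇u] dH^{n-1} ≥ −(1/3) ∫_{S^{n-1}} ( λ₂^{∇²u} + λ₃^{∇²u} + ⋯ + λ_{n-1}^{∇²u} ) |∇u|² dH^{n-1}, i.e. the sum in the right-hand side extends over all eigenvalues of ∇²u except the smallest one. -/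

import Mathlib

open MeasureTheory Metric Set Real
open scoped ENNReal RealInnerProductSpace

noncomputable section

abbrev Euc (n : ℕ) := EuclideanSpace ℝ (Fin n)

/-- Divergence of a vector field on Euclidean space: trace of its Fréchet derivative.
For a vector field which is tangent to the unit sphere and homogeneous along rays, this
coincides on the sphere with the divergence on the sphere. -/
def divg {n : ℕ} (W : Euc n → Euc n) (x : Euc n) : ℝ :=
  LinearMap.trace ℝ (Euc n) (fderiv ℝ W x).toLinearMap

/-- Laplacian (trace of the Hessian). For a `0`-homogeneous function this coincides on the
unit sphere with the Laplace–Beltrami operator of the sphere. -/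
def lapl {n : ℕ} (u : Euc n → ℝ) (x : Euc n) : ℝ := divg (gradient u) x

/-- The Hessian of `u` as a bilinear form: `hessBil u x X Y = D²u(x)[X, Y]`. For a
`0`-homogeneous `u` and `X, Y` tangent to the unit sphere at `x`, this coincides with the
covariant Hessian of `u` on the sphere. -/
def hessBil {n : ℕ} (u : Euc n → ℝ) (x X Y : Euc n) : ℝ :=
  ⟪fderiv ℝ (gradient u) x X, Y⟫

/-- A smooth function on the unit sphere `S^{n-1}`, encoded as a `0`-homogeneous smooth
function on `ℝⁿ \ {0}`. For such a function, `gradient`, `hessBil`, `lapl` and `divg`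
coincide on `S^{n-1}` with the corresponding intrinsic operators of the sphere. -/
def IsSphereFun {n : ℕ} (u : Euc n → ℝ) : Prop :=
  ContDiffOn ℝ (⊤ : ℕ∞) u {x : Euc n | x ≠ 0} ∧
    ∀ x : Euc n, x ≠ 0 → ∀ t : ℝ, 0 < t → u (t • x) = u x

/-- The smallest eigenvalue of the Hessian of `u` on the sphere at `x ∈ S^{n-1}`:
the infimum of the Rayleigh quotients `∇²u(x)[e, e]` over unit tangent vectors `e`. -/
def smallestHessEigenvalue {n : ℕ} (u : Euc n → ℝ) (x : Euc n) : ℝ :=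
  sInf ((fun e => hessBil u x e e) '' {e : Euc n | ‖e‖ = 1 ∧ ⟪e, x⟫ = 0})

/-- Central projection onto the unit sphere of the hyperplane where the `i`-th coordinate is `s`. -/
def cubeFaceToSphere {m : ℕ} (i : Fin (m + 1)) (s : ℝ) (y : Fin m → ℝ) : Euc (m + 1) :=
  ‖(WithLp.toLp 2 (i.insertNth s y : Fin (m + 1) → ℝ) : Euc (m + 1))‖⁻¹ •
    WithLp.toLp 2 (i.insertNth s y : Fin (m + 1) → ℝ)

lemma contDiff_cubeFaceToSphere {m : ℕ} (i : Fin (m + 1)) {s : ℝ} (hs : s ≠ 0) :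
    ContDiff ℝ 1 (cubeFaceToSphere i s) := by
  have hP : ContDiff ℝ 1 (fun y : Fin m → ℝ =>
      (WithLp.toLp 2 (i.insertNth s y : Fin (m + 1) → ℝ) : Euc (m + 1))) := by
    rw [contDiff_euclidean]
    intro k
    refine Fin.succAboveCases i ?_ (fun j => ?_) k
    · simpa using contDiff_const
    · simpa using contDiff_apply ℝ ℝ j
  have h0 (y : Fin m → ℝ) :
      (WithLp.toLp 2 (i.insertNth s y : Fin (m + 1) → ℝ) : Euc (m + 1)) ≠ 0 := fun h => hs <| by
    simpa using congrArg (fun v : Euc (m + 1) => v i) h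
  exact ((hP.norm ℝ h0).inv fun y => norm_ne_zero_iff.2 (h0 y)).smul hP

lemma sphere_subset_iUnion_cubeFaceToSphere (m : ℕ) :
    sphere (0 : Euc (m + 1)) 1 ⊆ ⋃ i : Fin (m + 1), ⋃ s ∈ ({1, -1} : Set ℝ),
      cubeFaceToSphere i s '' Icc (-1) 1 := by
  intro x hx
  have hx1 : ‖x‖ = 1 := by simpa using hx
  obtain ⟨i, -, hi⟩ := Finset.exists_max_image Finset.univ (fun k => |x k|) Finset.univ_nonempty
  have hxi : x i ≠ 0 := by
    intro h
    have hx0 : x = 0 := by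
      ext k
      have := hi k (Finset.mem_univ k)
      simp only [h, abs_zero] at this
      simpa using this
    simp [hx0] at hx1
  have hpos : 0 < |x i| := abs_pos.2 hxi
  have key : (WithLp.toLp 2 (i.insertNth (|x i|⁻¹ * x i) (fun j => |x i|⁻¹ * x (i.succAbove j)) :
      Fin (m + 1) → ℝ) : Euc (m + 1)) = |x i|⁻¹ • x := by
    ext k
    refine Fin.succAboveCases i ?_ (fun j => ?_) k <;> simp
  simp only [mem_iUnion]
  refine ⟨i, |x i|⁻¹ * x i, ?_, fun j => |x i|⁻¹ * x (i.succAbove j), ?_, ?_⟩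
  · rcases lt_or_gt_of_ne hxi with h | h
    · right
      rw [abs_of_neg h, mem_singleton_iff]
      field_simp
    · left
      rw [abs_of_pos h]
      field_simp
  · rw [mem_Icc, Pi.le_def, Pi.le_def, ← forall_and]
    intro j
    have := hi (i.succAbove j) (Finset.mem_univ _)
    rw [Pi.neg_apply, Pi.one_apply, ← abs_le, abs_mul, abs_inv, abs_abs, inv_mul_le_iff₀ hpos]
    simpa using this
  · rw [cubeFaceToSphere, key, norm_smul, hx1, smul_smul]
    simp [hpos.ne']

lemma hausdorffMeasure_sphere_lt_top (n : ℕ) (hn : 1 ≤ n) :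
    μH[(n : ℝ) - 1] (sphere (0 : Euc n) 1) < ∞ := by
  obtain ⟨m, rfl⟩ := Nat.exists_eq_add_of_le' hn
  have hm : ((m + 1 : ℕ) : ℝ) - 1 = m := by push_cast; ring
  rw [hm]
  refine (measure_mono (sphere_subset_iUnion_cubeFaceToSphere m)).trans_lt ?_
  refine (measure_iUnion_le _).trans_lt ?_
  rw [tsum_fintype]
  refine ENNReal.sum_lt_top.2 fun i _ => ?_
  refine (measure_biUnion_lt_top (by simp) fun s hs => ?_)
  have hs0 : s ≠ 0 := by
    rcases hs with rfl | rfl <;> norm_num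
  obtain ⟨K, hK⟩ := (contDiff_cubeFaceToSphere i hs0).locallyLipschitz.locallyLipschitzOn
    |>.exists_lipschitzOnWith_of_compact (isCompact_Icc : IsCompact (Icc (-1 : Fin m → ℝ) 1))
  refine (hK.hausdorffMeasure_image_le (Nat.cast_nonneg m)).trans_lt ?_
  refine ENNReal.mul_lt_top (ENNReal.rpow_lt_top_of_nonneg (Nat.cast_nonneg m) (by simp)) ?_
  have : (μH[(m : ℝ)] : Measure (Fin m → ℝ)) = volume := by
    simpa using hausdorffMeasure_pi_real (ι := Fin m)
  rw [this]
  exact isCompact_Icc.measure_lt_top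

section Rotations

variable {n : ℕ} (A : Euc n →L[ℝ] Euc n)

lemma hasDerivAt_exp_smul_apply (x : Euc n) (t : ℝ) :
    HasDerivAt (fun r : ℝ => NormedSpace.exp (r • A) x) (A (NormedSpace.exp (t • A) x)) t :=
  (hasDerivAt_exp_smul_const' A t).clm_apply (hasDerivAt_const t x) |>.congr_deriv (by simp)

lemma exp_zero_smul_apply (x : Euc n) : NormedSpace.exp ((0 : ℝ) • A) x = x := by
  have h : (0 : ℝ) • A = 0 := by ext; simp
  rw [h, NormedSpace.exp_zero, one_apply_eq_self]

lemma norm_exp_smul_apply_of_skew (hA : ∀ x, ⟪A x, x⟫ = 0) (t : ℝ) (x : Euc n) :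
    ‖NormedSpace.exp (t • A) x‖ = ‖x‖ := by
  have hd (r : ℝ) := (hasDerivAt_exp_smul_apply A x r).norm_sq
  have h := is_const_of_deriv_eq_zero (fun r => (hd r).differentiableAt)
    (fun r => by rw [(hd r).deriv, real_inner_comm, hA, mul_zero]) t 0
  rw [exp_zero_smul_apply] at h
  exact (sq_eq_sq₀ (norm_nonneg _) (norm_nonneg _)).1 h

/-- The one-parameter group of rotations generated by a skew-symmetric endomorphism. -/
def skewRotation (hA : ∀ x, ⟪A x, x⟫ = 0) (t : ℝ) : Euc n ≃ₗᵢ[ℝ] Euc n :=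
  LinearIsometry.toLinearIsometryEquiv
    ⟨(NormedSpace.exp (t • A) : Euc n →L[ℝ] Euc n).toLinearMap,
      norm_exp_smul_apply_of_skew A hA t⟩ rfl

lemma skewRotation_apply (hA : ∀ x, ⟪A x, x⟫ = 0) (t : ℝ) (x : Euc n) :
    skewRotation A hA t x = NormedSpace.exp (t • A) x := rfl

lemma setIntegral_sphere_comp_linearIsometryEquiv (d : ℝ) (e : Euc n ≃ₗᵢ[ℝ] Euc n)
    (f : Euc n → ℝ) :
    ∫ x in sphere (0 : Euc n) 1, f (e x) ∂μH[d] = ∫ x in sphere (0 : Euc n) 1, f x ∂μH[d] := by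
  have h := (e.toIsometryEquiv.measurePreserving_hausdorffMeasure d).setIntegral_preimage_emb
    e.toHomeomorph.measurableEmbedding f (sphere 0 1)
  have hs : e.toIsometryEquiv ⁻¹' sphere (0 : Euc n) 1 = sphere 0 1 := by
    ext x; simp
  rw [hs] at h
  exact h

lemma sphere_subset_ne_zero : sphere (0 : Euc n) 1 ⊆ {x | x ≠ 0} :=
  fun _ hx => ne_zero_of_mem_unit_sphere ⟨_, hx⟩

lemma integrableOn_sphere_of_continuousOn {d : ℝ} (hd : μH[d] (sphere (0 : Euc n) 1) < ∞)
    {f : Euc n → ℝ} (hf : ContinuousOn f (sphere 0 1)) :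
    IntegrableOn f (sphere (0 : Euc n) 1) μH[d] := by
  obtain ⟨C, hC⟩ := (isCompact_sphere (0 : Euc n) 1).exists_bound_of_continuousOn hf
  exact IntegrableOn.of_bound hd
    (hf.aestronglyMeasurable isClosed_sphere.measurableSet) C
    ((ae_restrict_iff' isClosed_sphere.measurableSet).2 (ae_of_all _ hC))

lemma setIntegral_sphere_fderiv_skew_eq_zero {d : ℝ} (hd : μH[d] (sphere (0 : Euc n) 1) < ∞)
    (hA : ∀ x, ⟪A x, x⟫ = 0) {f : Euc n → ℝ} (hf : ContDiffOn ℝ 1 f {x | x ≠ 0}) :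
    ∫ x in sphere (0 : Euc n) 1, fderiv ℝ f x (A x) ∂μH[d] = 0 := by
  have hmem (t : ℝ) {x : Euc n} (hx : x ∈ sphere (0 : Euc n) 1) :
      skewRotation A hA t x ∈ sphere (0 : Euc n) 1 := by simpa using hx
  have hopen : IsOpen {x : Euc n | x ≠ 0} := isOpen_ne
  have hcont : ContinuousOn (fun x => fderiv ℝ f x (A x)) (sphere (0 : Euc n) 1) :=
    ((hf.continuousOn_fderiv_of_isOpen hopen le_rfl).mono sphere_subset_ne_zero).clm_apply
      A.continuous.continuousOn
  obtain ⟨C, hC⟩ := (isCompact_sphere (0 : Euc n) 1).exists_bound_of_continuousOn hcont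
  have hfc : ContinuousOn f (sphere (0 : Euc n) 1) := hf.continuousOn.mono sphere_subset_ne_zero
  have hms : MeasurableSet (sphere (0 : Euc n) 1) := isClosed_sphere.measurableSet
  have hder := (hasDerivAt_integral_of_dominated_loc_of_deriv_le
    (μ := (μH[d] : Measure (Euc n)).restrict (sphere 0 1)) (x₀ := (0 : ℝ)) (s := univ)
    (F := fun t x => f (skewRotation A hA t x))
    (F' := fun t x => fderiv ℝ f (skewRotation A hA t x) (A (skewRotation A hA t x)))
    (bound := fun _ => C) Filter.univ_mem
    (Filter.Eventually.of_forall fun t =>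
      (hfc.comp (skewRotation A hA t).continuous.continuousOn
        fun x hx => hmem t hx).aestronglyMeasurable hms)
    (integrableOn_sphere_of_continuousOn hd <|
      hfc.comp (skewRotation A hA 0).continuous.continuousOn fun x hx => hmem 0 hx)
    ((hcont.comp (skewRotation A hA 0).continuous.continuousOn
        fun x hx => hmem 0 hx).aestronglyMeasurable hms)
    ((ae_restrict_iff' hms).2 (ae_of_all _ fun x hx t _ => hC _ (hmem t hx)))
    (integrableOn_sphere_of_continuousOn hd continuousOn_const)
    ((ae_restrict_iff' hms).2 (ae_of_all _ fun x hx t _ => by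
      have hdf : DifferentiableAt ℝ f (skewRotation A hA t x) :=
        (hf.differentiableOn one_ne_zero).differentiableAt
          (hopen.mem_nhds (sphere_subset_ne_zero (hmem t hx)))
      exact hdf.hasFDerivAt.comp_hasDerivAt t (hasDerivAt_exp_smul_apply A x t)))).2
  have hconst : (fun t => ∫ x in sphere (0 : Euc n) 1, f (skewRotation A hA t x) ∂μH[d])
      = fun _ => ∫ x in sphere (0 : Euc n) 1, f x ∂μH[d] :=
    funext fun t => setIntegral_sphere_comp_linearIsometryEquiv d _ f
  rw [hconst] at hder
  simpa only [skewRotation_apply, exp_zero_smul_apply] using hder.unique (hasDerivAt_const 0 _)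

end Rotations

section DivergenceTheorem

variable {n : ℕ}

/-- The generator of the rotations in the plane of the `i`-th and `j`-th coordinate axes. -/
def planeRotationGenerator (i j : Fin n) : Euc n →L[ℝ] Euc n :=
  (EuclideanSpace.proj i : Euc n →L[ℝ] ℝ).smulRight (EuclideanSpace.single j 1) -
    (EuclideanSpace.proj j : Euc n →L[ℝ] ℝ).smulRight (EuclideanSpace.single i 1)

lemma planeRotationGenerator_apply (i j : Fin n) (x : Euc n) :
    planeRotationGenerator i j x =
      x i • EuclideanSpace.single j 1 - x j • EuclideanSpace.single i 1 := rfl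

lemma inner_planeRotationGenerator_self (i j : Fin n) (x : Euc n) :
    ⟪planeRotationGenerator i j x, x⟫ = 0 := by
  rw [planeRotationGenerator_apply, inner_sub_left, real_inner_smul_left, real_inner_smul_left,
    EuclideanSpace.inner_single_left, EuclideanSpace.inner_single_left]
  simp
  ring

lemma divg_eq_sum (W : Euc n → Euc n) (x : Euc n) :
    divg W x = ∑ j, fderiv ℝ W x (EuclideanSpace.single j 1) j := by
  rw [divg, LinearMap.trace_eq_sum_inner _ (EuclideanSpace.basisFun (Fin n) ℝ)]
  simp [EuclideanSpace.inner_single_left]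

lemma sum_smul_single (x : Euc n) : ∑ i, x i • (EuclideanSpace.single i 1 : Euc n) = x := by
  simpa using (EuclideanSpace.basisFun (Fin n) ℝ).sum_repr x

lemma inner_eq_sum_mul (x y : Euc n) : ⟪x, y⟫ = ∑ i, x i * y i := by
  simp [PiLp.inner_apply, mul_comm]

lemma sum_fderiv_planeRotationGenerator {W : Euc n → Euc n} {x : Euc n} (hx : ‖x‖ = 1)
    (hW : DifferentiableAt ℝ W x) (ht : ⟪W x, x⟫ = 0) (hr : ⟪fderiv ℝ W x x, x⟫ = 0) :
    ∑ i, ∑ j, fderiv ℝ (fun y => y i * W y j) x (planeRotationGenerator i j x) = divg W x := by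
  have hder (i j : Fin n) (v : Euc n) :
      fderiv ℝ (fun y => y i * W y j) x v = x i * fderiv ℝ W x v j + W x j * v i := by
    have h1 : HasFDerivAt (fun y : Euc n => y i) (EuclideanSpace.proj i : Euc n →L[ℝ] ℝ) x :=
      (EuclideanSpace.proj i : Euc n →L[ℝ] ℝ).hasFDerivAt
    have h2 : HasFDerivAt (fun y : Euc n => W y j)
        ((EuclideanSpace.proj j : Euc n →L[ℝ] ℝ).comp (fderiv ℝ W x)) x :=
      (EuclideanSpace.proj j : Euc n →L[ℝ] ℝ).hasFDerivAt.comp x hW.hasFDerivAt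
    have h := (h1.mul h2).fderiv
    rw [show (fun y => y i * W y j) = (fun y : Euc n => y i) * fun y => W y j from rfl, h]
    simp
  have hxx : ∑ i, x i * x i = 1 := by
    rw [← inner_eq_sum_mul, real_inner_self_eq_norm_sq, hx, one_pow]
  rw [inner_eq_sum_mul] at ht hr
  have hterm (i j : Fin n) :
      fderiv ℝ (fun y => y i * W y j) x (planeRotationGenerator i j x) =
        x i * x i * fderiv ℝ W x (EuclideanSpace.single j 1) j
          - x j * (x i * fderiv ℝ W x (EuclideanSpace.single i 1) j)
          + (if i = j then W x j * x j else 0) - W x j * x j := by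
    rw [hder, planeRotationGenerator_apply]
    by_cases h : i = j
    · subst h; simp; ring
    · simp [h]; ring
  have hrad (j : Fin n) :
      ∑ i, x i * fderiv ℝ W x (EuclideanSpace.single i 1) j = fderiv ℝ W x x j := by
    have h := congrArg (fderiv ℝ W x) (sum_smul_single x)
    rw [← h, map_sum]
    simp
  simp_rw [hterm, Finset.sum_sub_distrib, Finset.sum_add_distrib, Finset.sum_sub_distrib]
  rw [Finset.sum_comm (f := fun i j => x j * (x i * fderiv ℝ W x (EuclideanSpace.single i 1) j))]
  simp_rw [← Finset.mul_sum, hrad, ← Finset.sum_mul, ← divg_eq_sum]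
  have hr' : ∑ j, x j * fderiv ℝ W x x j = 0 := by simpa [mul_comm] using hr
  simp [hxx, hr', ht]

/-- The divergence theorem on the unit sphere for tangent vector fields. -/
lemma setIntegral_sphere_divg_eq_zero {d : ℝ} (hd : μH[d] (sphere (0 : Euc n) 1) < ∞)
    {W : Euc n → Euc n} (hW : ContDiffOn ℝ 1 W {x | x ≠ 0}) (ht : ∀ x ≠ 0, ⟪W x, x⟫ = 0) :
    ∫ x in sphere (0 : Euc n) 1, divg W x ∂μH[d] = 0 := by
  have hopen : IsOpen {x : Euc n | x ≠ 0} := isOpen_ne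
  have hdiff {x : Euc n} (hx : x ≠ 0) : DifferentiableAt ℝ W x :=
    (hW.differentiableOn one_ne_zero).differentiableAt (hopen.mem_nhds hx)
  have hrad {x : Euc n} (hx : x ≠ 0) : ⟪fderiv ℝ W x x, x⟫ = 0 := by
    have h1 : HasFDerivAt (fun y => ⟪W y, y⟫) _ x :=
      (hdiff hx).hasFDerivAt.inner ℝ (hasFDerivAt_id x)
    have h2 : HasFDerivAt (fun y => ⟪W y, y⟫) (0 : Euc n →L[ℝ] ℝ) x :=
      (hasFDerivAt_const (0 : ℝ) x).congr_of_eventuallyEq <| by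
        filter_upwards [hopen.mem_nhds hx] with y hy using ht y hy
    simpa [ht x hx] using congrArg (fun L : Euc n →L[ℝ] ℝ => L x) (h1.unique h2)
  have hf (i j : Fin n) : ContDiffOn ℝ 1 (fun y : Euc n => y i * W y j) {x | x ≠ 0} :=
    (EuclideanSpace.proj i : Euc n →L[ℝ] ℝ).contDiff.contDiffOn.mul
      ((contDiffOn_euclidean.1 hW) j)
  calc ∫ x in sphere (0 : Euc n) 1, divg W x ∂μH[d]
      = ∫ x in sphere (0 : Euc n) 1, ∑ i, ∑ j,
          fderiv ℝ (fun y => y i * W y j) x (planeRotationGenerator i j x) ∂μH[d] := by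
        refine setIntegral_congr_fun isClosed_sphere.measurableSet fun x hx => ?_
        have hx0 := sphere_subset_ne_zero hx
        exact (sum_fderiv_planeRotationGenerator (by simpa using hx) (hdiff hx0) (ht x hx0)
          (hrad hx0)).symm
    _ = 0 := by
        have hint (i j : Fin n) : IntegrableOn (fun x =>
            fderiv ℝ (fun y => y i * W y j) x (planeRotationGenerator i j x))
            (sphere (0 : Euc n) 1) μH[d] :=
          integrableOn_sphere_of_continuousOn hd <|
            (((hf i j).continuousOn_fderiv_of_isOpen hopen le_rfl).mono
              sphere_subset_ne_zero).clm_apply (planeRotationGenerator i j).continuous.continuousOn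
        rw [integral_finsetSum _ fun i _ => integrable_finsetSum _ fun j _ => hint i j]
        refine Finset.sum_eq_zero fun i _ => ?_
        rw [integral_finsetSum _ fun j _ => hint i j]
        exact Finset.sum_eq_zero fun j _ => setIntegral_sphere_fderiv_skew_eq_zero _ hd
          (inner_planeRotationGenerator_self i j) (hf i j)

end DivergenceTheorem

section SphereFunctions

variable {n : ℕ} {u : Euc n → ℝ}

lemma IsSphereFun.contDiffOn_gradient (hu : IsSphereFun u) :
    ContDiffOn ℝ 2 (gradient u) {x | x ≠ 0} := by
  rw [contDiffOn_euclidean]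
  intro i
  have h : ContDiffOn ℝ 2 (fderiv ℝ u) {x | x ≠ 0} :=
    (hu.1.of_le (m := 3) (WithTop.coe_le_coe.2 (le_top : (3 : ℕ∞) ≤ ⊤))).fderiv_of_isOpen isOpen_ne (by norm_num)
  have hi (x : Euc n) : gradient u x i = fderiv ℝ u x (EuclideanSpace.single i 1) := by
    rw [← inner_gradient_left, EuclideanSpace.inner_single_right]
    simp
  simp_rw [hi]
  exact h.clm_apply contDiffOn_const

lemma IsSphereFun.inner_gradient_self (hu : IsSphereFun u) {x : Euc n} (hx : x ≠ 0) :
    ⟪gradient u x, x⟫ = 0 := by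
  rw [inner_gradient_left]
  have hd : DifferentiableAt ℝ u x :=
    (hu.1.differentiableOn (by simp)).differentiableAt (isOpen_ne.mem_nhds hx)
  have h1 : HasDerivAt (fun t : ℝ => u (t • x)) (fderiv ℝ u x x) 1 := by
    have hs : HasDerivAt (fun t : ℝ => t • x) x 1 := by
      simpa using (hasDerivAt_id (1 : ℝ)).smul_const x
    refine HasFDerivAt.comp_hasDerivAt (l := u) (f := fun t : ℝ => t • x) 1 ?_ hs
    rw [one_smul]
    exact hd.hasFDerivAt
  have h2 : HasDerivAt (fun t : ℝ => u (t • x)) 0 1 :=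
    (hasDerivAt_const (1 : ℝ) (u x)).congr_of_eventuallyEq <| by
      filter_upwards [lt_mem_nhds (zero_lt_one : (0 : ℝ) < 1)] with t ht using hu.2 x hx t ht
  exact h1.unique h2

lemma divg_norm_sq_smul_self {V : Euc n → Euc n} {x : Euc n} (hV : DifferentiableAt ℝ V x) :
    divg (fun y => ‖V y‖ ^ 2 • V y) x =
      2 * ⟪fderiv ℝ V x (V x), V x⟫ + ‖V x‖ ^ 2 * divg V x := by
  have h := hV.hasFDerivAt.norm_sq.smul hV.hasFDerivAt
  have h' : fderiv ℝ (fun y => ‖V y‖ ^ 2 • V y) x = _ := h.fderiv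
  simp_rw [divg_eq_sum, h', Finset.mul_sum]
  have hsum : ⟪fderiv ℝ V x (V x), V x⟫ =
      ∑ j, V x j * ⟪V x, fderiv ℝ V x (EuclideanSpace.single j 1)⟫ := by
    have hV' := congrArg (fderiv ℝ V x) (sum_smul_single (V x))
    rw [map_sum] at hV'
    rw [← hV', sum_inner]
    simp only [map_smul, real_inner_smul_right, real_inner_comm]
  rw [hsum, Finset.mul_sum, ← Finset.sum_add_distrib]
  refine Finset.sum_congr rfl fun j _ => ?_
  simp
  ring

lemma abs_hessBil_self_le (u : Euc n → ℝ) (x : Euc n) {e : Euc n} (he : ‖e‖ = 1) :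
    |hessBil u x e e| ≤ ‖fderiv ℝ (gradient u) x‖ := by
  have h1 := abs_real_inner_le_norm (fderiv ℝ (gradient u) x e) e
  have h2 := (fderiv ℝ (gradient u) x).le_opNorm e
  rw [he, mul_one] at h1 h2
  exact h1.trans h2

lemma smallestHessEigenvalue_le (u : Euc n → ℝ) {x e : Euc n} (he : ‖e‖ = 1)
    (hx : ⟪e, x⟫ = 0) : smallestHessEigenvalue u x ≤ hessBil u x e e :=
  csInf_le ⟨-‖fderiv ℝ (gradient u) x‖, by
    rintro _ ⟨e', he', rfl⟩
    exact (abs_le.1 (abs_hessBil_self_le u x he'.1)).1⟩ ⟨e, ⟨he, hx⟩, rfl⟩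

lemma smallestHessEigenvalue_mul_norm_sq_le (u : Euc n → ℝ) {x v : Euc n} (hv : ⟪v, x⟫ = 0) :
    smallestHessEigenvalue u x * ‖v‖ ^ 2 ≤ hessBil u x v v := by
  rcases eq_or_ne v 0 with rfl | hv0
  · simp [hessBil]
  have hn : 0 < ‖v‖ := norm_pos_iff.2 hv0
  have h := smallestHessEigenvalue_le u (x := x) (e := ‖v‖⁻¹ • v)
    (by simp [norm_smul, hn.ne']) (by rw [real_inner_smul_left, hv, mul_zero])
  rw [hessBil, map_smul, real_inner_smul_left, real_inner_smul_right, ← hessBil] at h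
  calc smallestHessEigenvalue u x * ‖v‖ ^ 2
      ≤ (‖v‖⁻¹ * (‖v‖⁻¹ * hessBil u x v v)) * ‖v‖ ^ 2 := by gcongr
    _ = hessBil u x v v := by field_simp

lemma exists_norm_eq_one_inner_eq_zero (hn : 2 ≤ n) (x : Euc n) :
    ∃ e : Euc n, ‖e‖ = 1 ∧ ⟪e, x⟫ = 0 := by
  have : ∃ v ∈ (ℝ ∙ x)ᗮ, v ≠ 0 := by
    refine Submodule.exists_mem_ne_zero_of_ne_bot fun h => ?_
    have h1 := Submodule.finrank_add_finrank_orthogonal (ℝ ∙ x)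
    have h2 := finrank_span_le_card (R := ℝ) ({x} : Set (Euc n))
    rw [h, finrank_bot, finrank_euclideanSpace_fin] at h1
    rw [toFinset_singleton, Finset.card_singleton] at h2
    omega
  obtain ⟨v, hv, hv0⟩ := this
  rw [Submodule.mem_orthogonal_singleton_iff_inner_left] at hv
  exact ⟨‖v‖⁻¹ • v, by simp [norm_smul, hv0], by rw [real_inner_smul_left, hv, mul_zero]⟩

lemma abs_smallestHessEigenvalue_le (hn : 2 ≤ n) (u : Euc n → ℝ) (x : Euc n) :
    |smallestHessEigenvalue u x| ≤ ‖fderiv ℝ (gradient u) x‖ := by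
  obtain ⟨e, he, hex⟩ := exists_norm_eq_one_inner_eq_zero hn x
  refine abs_le.2 ⟨le_csInf ⟨_, e, ⟨he, hex⟩, rfl⟩ ?_,
    (smallestHessEigenvalue_le u he hex).trans (abs_le.1 (abs_hessBil_self_le u x he)).2⟩
  rintro _ ⟨e', he', rfl⟩
  exact (abs_le.1 (abs_hessBil_self_le u x he'.1)).1

lemma upperSemicontinuous_smallestHessEigenvalue (hn : 2 ≤ n)
    (hc : ContinuousOn (fderiv ℝ (gradient u)) {x | x ≠ 0}) :
    UpperSemicontinuous fun x : sphere (0 : Euc n) 1 => smallestHessEigenvalue u x := by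
  intro x₀ c hlt
  obtain ⟨e₀, he₀, hex₀⟩ := exists_norm_eq_one_inner_eq_zero hn (x₀ : Euc n)
  have hne : {e : Euc n | ‖e‖ = 1 ∧ ⟪e, (x₀ : Euc n)⟫ = 0}.Nonempty := ⟨e₀, he₀, hex₀⟩
  obtain ⟨_, ⟨e, ⟨he, hex⟩, rfl⟩, hec⟩ := exists_lt_of_csInf_lt (hne.image _) hlt
  let p : sphere (0 : Euc n) 1 → Euc n := fun x => e - ⟪e, (x : Euc n)⟫ • (x : Euc n)
  have hp : Continuous p := by fun_prop
  have hp₀ : p x₀ = e := by simp [p, hex]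
  have hpt (x : sphere (0 : Euc n) 1) : ⟪p x, (x : Euc n)⟫ = 0 := by
    simp [p, inner_sub_left, real_inner_smul_left]
  have hD : Continuous fun x : sphere (0 : Euc n) 1 => fderiv ℝ (gradient u) x :=
    hc.comp_continuous continuous_subtype_val fun x => ne_zero_of_mem_unit_sphere x
  have hcont : Continuous fun x : sphere (0 : Euc n) 1 =>
      c * ‖p x‖ ^ 2 - hessBil u x (p x) (p x) :=
    (continuous_const.mul (hp.norm.pow 2)).sub ((hD.clm_apply hp).inner hp)
  have hpos : 0 < c * ‖p x₀‖ ^ 2 - hessBil u x₀ (p x₀) (p x₀) := by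
    rw [hp₀, he]
    simpa using hec
  filter_upwards [hcont.continuousAt.eventually (lt_mem_nhds hpos)] with x hx
  have hle := smallestHessEigenvalue_mul_norm_sq_le u (hpt x)
  exact lt_of_mul_lt_mul_right (hle.trans_lt (sub_pos.1 hx)) (by positivity)

lemma IsSphereFun.integrableOn_smallestHessEigenvalue_mul (hn : 2 ≤ n) (hu : IsSphereFun u)
    {d : ℝ} (hd : μH[d] (sphere (0 : Euc n) 1) < ∞) {f : Euc n → ℝ}
    (hf : ContinuousOn f (sphere 0 1)) :
    IntegrableOn (fun x => smallestHessEigenvalue u x * f x) (sphere (0 : Euc n) 1) μH[d] := by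
  have hms : MeasurableSet (sphere (0 : Euc n) 1) := isClosed_sphere.measurableSet
  have hc : ContinuousOn (fderiv ℝ (gradient u)) {x | x ≠ 0} :=
    hu.contDiffOn_gradient.continuousOn_fderiv_of_isOpen isOpen_ne (by norm_num)
  obtain ⟨C, hC⟩ := (isCompact_sphere (0 : Euc n) 1).exists_bound_of_continuousOn
    (hc.mono sphere_subset_ne_zero)
  refine (integrableOn_sphere_of_continuousOn hd hf).bdd_mul (c := C) ?_ ?_
  · exact (aemeasurable_restrict_of_measurable_subtype hms
      (upperSemicontinuous_smallestHessEigenvalue hn hc).measurable).aestronglyMeasurable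
  · exact (ae_restrict_iff' hms).2 (ae_of_all _ fun x hx =>
      (abs_smallestHessEigenvalue_le hn u x).trans (hC x hx))

end SphereFunctions

/-- Let `n ≥ 3` and let `u : S^{n-1} → ℝ` be smooth, with Hessian
eigenvalues `λ₁ ≤ ⋯ ≤ λ_{n-1}` at each point. Then
`∫_{S^{n-1}} ∇²u[∇u, ∇u] ≥ −(1/3) ∫_{S^{n-1}} (λ₂ + ⋯ + λ_{n-1}) |∇u|²`,
where the sum on the right-hand side extends over all eigenvalues of `∇²u` except the
smallest one, i.e. it equals `Δu − λ₁`. -/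
theorem hessian_cubic_term_lower_bound (n : ℕ) (hn : 3 ≤ n)
    (u : Euc n → ℝ) (hu : IsSphereFun u) :
    (∫ x in sphere (0 : Euc n) 1,
        hessBil u x (gradient u x) (gradient u x) ∂μH[(n : ℝ) - 1])
      ≥ -(1 / 3) * ∫ x in sphere (0 : Euc n) 1,
          (lapl u x - smallestHessEigenvalue u x) * ‖gradient u x‖ ^ 2 ∂μH[(n : ℝ) - 1] := by
  have hd : μH[(n : ℝ) - 1] (sphere (0 : Euc n) 1) < ∞ :=
    hausdorffMeasure_sphere_lt_top n (by omega)
  have hg := hu.contDiffOn_gradient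
  have hg1 : ContDiffOn ℝ 1 (gradient u) {x | x ≠ 0} := hg.of_le (by norm_num)
  have hgc : ContinuousOn (gradient u) (sphere 0 1) := hg.continuousOn.mono sphere_subset_ne_zero
  have hDc : ContinuousOn (fderiv ℝ (gradient u)) (sphere 0 1) :=
    (hg1.continuousOn_fderiv_of_isOpen isOpen_ne le_rfl).mono sphere_subset_ne_zero
  have hlc : ContinuousOn (lapl u) (sphere 0 1) := by
    have h : lapl u = fun x => ∑ j, fderiv ℝ (gradient u) x (EuclideanSpace.single j 1) j :=
      funext fun x => divg_eq_sum _ x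
    rw [h]
    exact continuousOn_finsetSum _ fun j _ => (EuclideanSpace.proj j : Euc n →L[ℝ] ℝ).continuous
      |>.comp_continuousOn (hDc.clm_apply continuousOn_const)
  have hH : IntegrableOn (fun x => hessBil u x (gradient u x) (gradient u x))
      (sphere (0 : Euc n) 1) μH[(n : ℝ) - 1] :=
    integrableOn_sphere_of_continuousOn hd ((hDc.clm_apply hgc).inner hgc)
  have hL : IntegrableOn (fun x => lapl u x * ‖gradient u x‖ ^ 2)
      (sphere (0 : Euc n) 1) μH[(n : ℝ) - 1] :=
    integrableOn_sphere_of_continuousOn hd (hlc.mul (hgc.norm.pow 2))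
  have hE : IntegrableOn (fun x => smallestHessEigenvalue u x * ‖gradient u x‖ ^ 2)
      (sphere (0 : Euc n) 1) μH[(n : ℝ) - 1] :=
    hu.integrableOn_smallestHessEigenvalue_mul (by omega) hd (hgc.norm.pow 2)
  have hdiv := setIntegral_sphere_divg_eq_zero hd
    (W := fun y => ‖gradient u y‖ ^ 2 • gradient u y) ((hg1.norm_sq ℝ).smul hg1)
    fun x hx => by rw [real_inner_smul_left, hu.inner_gradient_self hx, mul_zero]
  have hibp : 2 * (∫ x in sphere (0 : Euc n) 1,
        hessBil u x (gradient u x) (gradient u x) ∂μH[(n : ℝ) - 1]) +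
      ∫ x in sphere (0 : Euc n) 1, lapl u x * ‖gradient u x‖ ^ 2 ∂μH[(n : ℝ) - 1] = 0 := by
    rw [← integral_const_mul, ← integral_add (hH.const_mul 2) hL, ← hdiv]
    refine setIntegral_congr_fun isClosed_sphere.measurableSet fun x hx => ?_
    have hdx : DifferentiableAt ℝ (gradient u) x := (hg1.differentiableOn one_ne_zero)
      |>.differentiableAt (isOpen_ne.mem_nhds (sphere_subset_ne_zero hx))
    simp only [divg_norm_sq_smul_self hdx, hessBil, lapl, mul_comm]
  have hmono := setIntegral_mono_on hE hH isClosed_sphere.measurableSet fun x hx =>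
    smallestHessEigenvalue_mul_norm_sq_le u (hu.inner_gradient_self (sphere_subset_ne_zero hx))
  simp_rw [sub_mul]
  rw [integral_sub hL hE]
  linarith
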